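/- Let m be a positive integer and k a field in which m is invertible and which contains a primitive m-th root of unity. Let A be a finite abelian group of exponent dividing m. Let A act on the field of rational functions L = k(x_a : a ∈ A) in variables indexed by the elements of A, by k-automorphisms determined by b · x_a = x_{ba} for a, b ∈ A, and let K = L^A be the fixed field. Then K is stably rational over k: there exist natural numbers n and n' and an isomorphism of field extensions of k between K(t₁, …, t_n) (a purely transcendental extension of K in n variables) and the rational function field k(s₁, …, s_{n'}). -/

import Mathlib

section LaurentMonomial

variable {k L ι G : Type*} [Field k] [Field L] [Algebra k L] [Fintype ι]

/-- The Laurent monomial `∏ i, y i ^ m i`. -/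
noncomputable def laurentMonomial (y : ι → L) (m : ι → ℤ) : L := ∏ i, y i ^ m i

theorem laurentMonomial_zero (y : ι → L) : laurentMonomial y 0 = 1 := by
  simp [laurentMonomial]

theorem laurentMonomial_add {y : ι → L} (hy : ∀ i, y i ≠ 0) (m m' : ι → ℤ) :
    laurentMonomial y (m + m') = laurentMonomial y m * laurentMonomial y m' := by
  simp [laurentMonomial, zpow_add₀ (hy _), Finset.prod_mul_distrib]

theorem laurentMonomial_ne_zero {y : ι → L} (hy : ∀ i, y i ≠ 0) (m : ι → ℤ) :
    laurentMonomial y m ≠ 0 :=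
  Finset.prod_ne_zero_iff.2 fun i _ ↦ zpow_ne_zero _ (hy i)

theorem laurentMonomial_neg {y : ι → L} (m : ι → ℤ) :
    laurentMonomial y (-m) = (laurentMonomial y m)⁻¹ := by
  simp [laurentMonomial]

theorem laurentMonomial_zsmul {y : ι → L} (n : ℤ) (m : ι → ℤ) :
    laurentMonomial y (n • m) = laurentMonomial y m ^ n := by
  simp [laurentMonomial, zpow_mul, Finset.prod_zpow, mul_comm n]

theorem laurentMonomial_sum {y : ι → L} (hy : ∀ i, y i ≠ 0) {κ : Type*} (s : Finset κ)
    (n : κ → ℤ) (b : κ → ι → ℤ) :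
    laurentMonomial y (∑ j ∈ s, n j • b j) = ∏ j ∈ s, laurentMonomial y (b j) ^ n j := by
  classical
  induction s using Finset.induction_on with
  | empty => simp [laurentMonomial_zero]
  | insert j s hj ih =>
    rw [Finset.sum_insert hj, Finset.prod_insert hj, laurentMonomial_add hy, ih,
      laurentMonomial_zsmul]

theorem aeval_eq_sum_laurentMonomial (y : ι → L) (p : MvPolynomial ι k) :
    MvPolynomial.aeval y p =
      ∑ s ∈ p.support, p.coeff s • laurentMonomial y (fun i ↦ (s i : ℤ)) := by
  rw [MvPolynomial.aeval_def, MvPolynomial.eval₂_eq']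
  simp [laurentMonomial, Algebra.smul_def]

theorem AlgebraicIndependent.linearIndependent_laurentMonomial {y : ι → L}
    (hy : AlgebraicIndependent k y) : LinearIndependent k (laurentMonomial y) := by
  classical
  have hy0 : ∀ i, y i ≠ 0 := fun i ↦ hy.ne_zero i
  rw [linearIndependent_iff']
  intro s c hc m₀ hm₀
  let N : ι → ℤ := fun i ↦ ∑ m ∈ s, |m i|
  have hN : ∀ m ∈ s, ∀ i, 0 ≤ m i + N i := fun m hm i ↦ by
    have h1 : |m i| ≤ N i := Finset.single_le_sum (f := fun m : ι → ℤ ↦ |m i|)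
      (fun _ _ ↦ abs_nonneg _) hm
    have h2 := neg_abs_le (m i)
    omega
  let e : (ι → ℤ) → (ι →₀ ℕ) := fun m ↦ Finsupp.equivFunOnFinite.symm fun i ↦ (m i + N i).toNat
  let p : MvPolynomial ι k := ∑ m ∈ s, MvPolynomial.monomial (e m) (c m)
  have hp : p = 0 := by
    refine (injective_iff_map_eq_zero _).1 hy p ?_
    have : MvPolynomial.aeval y p = (∑ m ∈ s, c m • laurentMonomial y m) * laurentMonomial y N := by
      rw [map_sum, Finset.sum_mul]
      refine Finset.sum_congr rfl fun m hm ↦ ?_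
      rw [smul_mul_assoc, ← laurentMonomial_add hy0, MvPolynomial.aeval_monomial,
        Algebra.smul_def, Finsupp.prod_fintype _ _ (by simp)]
      congr 1
      refine Finset.prod_congr rfl fun i _ ↦ ?_
      rw [← zpow_natCast]
      simp [e, Int.toNat_of_nonneg (hN m hm i)]
    rw [this, hc, zero_mul]
  have h := congrArg (MvPolynomial.coeff (e m₀)) hp
  rw [MvPolynomial.coeff_sum, Finset.sum_eq_single_of_mem m₀ hm₀] at h
  · simpa using h
  · intro m hm hne
    rw [MvPolynomial.coeff_monomial, if_neg]
    intro he
    apply hne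
    funext i
    have h1 : (m i + N i).toNat = (m₀ i + N i).toNat := DFunLike.congr_fun he i
    have := hN m hm i
    have := hN m₀ hm₀ i
    omega

theorem AlgebraicIndependent.laurentMonomial {y : ι → L} (hy : AlgebraicIndependent k y)
    {κ : Type*} [Fintype κ] {b : κ → ι → ℤ} (hb : LinearIndependent ℤ b) :
    AlgebraicIndependent k fun j ↦ laurentMonomial y (b j) := by
  have hy0 : ∀ i, y i ≠ 0 := fun i ↦ hy.ne_zero i
  have hinj : Function.Injective fun s : κ →₀ ℕ ↦ ∑ j, (s j : ℤ) • b j := by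
    intro s t hst
    ext j
    have := Fintype.linearIndependent_iff.1 hb (fun j ↦ (s j : ℤ) - t j) (by
      simp only [sub_smul, Finset.sum_sub_distrib]
      exact sub_eq_zero.2 hst) j
    exact_mod_cast sub_eq_zero.1 this
  have hli := hy.linearIndependent_laurentMonomial.comp _ hinj
  rw [algebraicIndependent_iff]
  intro p hp
  rw [aeval_eq_sum_laurentMonomial] at hp
  ext s
  by_cases hs : s ∈ p.support
  · refine linearIndependent_iff'.1 hli p.support p.coeff ?_ s hs
    rw [← hp]
    refine Finset.sum_congr rfl fun t _ ↦ ?_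
    rw [Function.comp_apply, laurentMonomial_sum hy0]
    rfl
  · simpa using hs

section Diagonal

variable {c : G → ι → kˣ}

/-- The lattice of exponents of the Laurent monomials fixed by a diagonal action. -/
def invariantExponents (c : G → ι → kˣ) : Submodule ℤ (ι → ℤ) :=
  AddSubgroup.toIntSubmodule
    { carrier := {m | ∀ g, ∏ i, c g i ^ m i = 1}
      zero_mem' := by simp
      add_mem' := fun {a b} ha hb g ↦ by
        simp only [Pi.add_apply, zpow_add, Finset.prod_mul_distrib, ha g, hb g, mul_one]
      neg_mem' := fun {a} ha g ↦ by
        simp only [Pi.neg_apply, zpow_neg, Finset.prod_inv_distrib, ha g, inv_one] }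

theorem mem_invariantExponents {m : ι → ℤ} :
    m ∈ invariantExponents c ↔ ∀ g, ∏ i, c g i ^ m i = 1 := Iff.rfl

variable [Group G] {ρ : G →* L ≃ₐ[k] L} {y : ι → L}

theorem map_laurentMonomial (hρ : ∀ g i, ρ g (y i) = (c g i : k) • y i) (g : G) (m : ι → ℤ) :
    ρ g (laurentMonomial y m) = ((∏ i, c g i ^ m i : kˣ) : k) • laurentMonomial y m := by
  simp [laurentMonomial, hρ, Algebra.smul_def, mul_zpow, Finset.prod_mul_distrib]

theorem aeval_mem_adjoin_of_invariant (hy : AlgebraicIndependent k y)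
    (hρ : ∀ g i, ρ g (y i) = (c g i : k) • y i) {p : MvPolynomial ι k}
    (hp : ∀ g, ρ g (MvPolynomial.aeval y p) = MvPolynomial.aeval y p) :
    MvPolynomial.aeval y p ∈
      IntermediateField.adjoin k (Set.image (laurentMonomial y) (invariantExponents c)) := by
  rw [aeval_eq_sum_laurentMonomial]
  refine sum_mem fun s hs ↦ IntermediateField.smul_mem _ <|
    IntermediateField.subset_adjoin k _ <| Set.mem_image_of_mem _ ?_
  refine mem_invariantExponents.2 fun g ↦ ?_
  have hinj : Function.Injective fun (s : ι →₀ ℕ) (i : ι) ↦ (s i : ℤ) := fun s t hst ↦ by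
    ext i
    exact Nat.cast_injective (R := ℤ) (congrFun hst i)
  have hli := hy.linearIndependent_laurentMonomial.comp _ hinj
  have h := linearIndependent_iff'.1 hli p.support
    (fun s ↦ p.coeff s * ((∏ i, c g i ^ (s i : ℤ) : kˣ) : k) - p.coeff s) (by
      have := hp g
      rw [aeval_eq_sum_laurentMonomial, map_sum] at this
      simp only [map_smul, map_laurentMonomial hρ] at this
      simp only [sub_smul, Finset.sum_sub_distrib, Function.comp_apply, mul_smul]
      exact sub_eq_zero.2 this) s hs
  have h0 : p.coeff s ≠ 0 := MvPolynomial.mem_support_iff.1 hs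
  exact Units.ext (mul_left_cancel₀ h0 (by simpa [sub_eq_zero] using h))

theorem fixedField_eq_adjoin_laurentMonomial [Finite G] (hy : AlgebraicIndependent k y)
    (hρ : ∀ g i, ρ g (y i) = (c g i : k) • y i)
    (hgen : ∀ f : L, ∃ p q : MvPolynomial ι k,
      MvPolynomial.aeval y q ≠ 0 ∧ f * MvPolynomial.aeval y q = MvPolynomial.aeval y p) :
    IntermediateField.fixedField ρ.range =
      IntermediateField.adjoin k (Set.image (laurentMonomial y) (invariantExponents c)) := by
  classical
  have := Fintype.ofFinite G
  apply le_antisymm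
  · intro f hf
    replace hf : ∀ g, ρ g f = f := fun g ↦ hf ⟨ρ g, g, rfl⟩
    obtain ⟨p, q, hq, hpq⟩ := hgen f
    let R : Subalgebra k L := (MvPolynomial.aeval y).range
    have hR : ∀ g, ∀ r ∈ R, ρ g r ∈ R := by
      rintro g _ ⟨r, rfl⟩
      change ρ g (MvPolynomial.aeval y r) ∈ R
      induction r using MvPolynomial.induction_on with
      | C a => simp
      | add r s hr hs => simpa using add_mem hr hs
      | mul_X r i hr =>
        rw [map_mul, map_mul, MvPolynomial.aeval_X, hρ]
        exact mul_mem hr (R.smul_mem ⟨MvPolynomial.X i, MvPolynomial.aeval_X y i⟩ _)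
    set Q := MvPolynomial.aeval y q
    have hQR : Q ∈ R := ⟨q, rfl⟩
    let N := ∏ g, ρ g Q
    have hN0 : N ≠ 0 := Finset.prod_ne_zero_iff.2 fun g _ ↦ by simpa using hq
    have hNR : N ∈ R := prod_mem fun g _ ↦ hR g _ hQR
    have hNinv : ∀ g, ρ g N = N := fun g ↦ by
      simp only [N, map_prod, ← AlgEquiv.mul_apply, ← map_mul]
      exact Fintype.prod_equiv (Equiv.mulLeft g) _ _ fun _ ↦ rfl
    have hfNR : f * N ∈ R := by
      have : N = Q * ∏ g ∈ Finset.univ.erase 1, ρ g Q := by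
        simp only [N]
        rw [← Finset.mul_prod_erase _ _ (Finset.mem_univ 1)]
        simp
      rw [this, ← mul_assoc, hpq]
      exact mul_mem ⟨p, rfl⟩ (prod_mem fun g _ ↦ hR g _ hQR)
    have hmem : ∀ r ∈ R, (∀ g, ρ g r = r) → r ∈ IntermediateField.adjoin k
        (Set.image (laurentMonomial y) (invariantExponents c)) := by
      rintro _ ⟨r, rfl⟩ hr
      exact aeval_mem_adjoin_of_invariant hy hρ hr
    rw [← mul_div_cancel_right₀ f hN0]
    exact div_mem (hmem _ hfNR fun g ↦ by rw [map_mul, hf, hNinv]) (hmem _ hNR hNinv)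
  · rw [IntermediateField.adjoin_le_iff]
    rintro _ ⟨m, hm, rfl⟩ ⟨_, g, rfl⟩
    change ρ g _ = _
    rw [map_laurentMonomial hρ, mem_invariantExponents.1 hm g, Units.val_one, one_smul]

/-- The fixed field of a diagonal action of a finite group on a rational function field is
rational. -/
theorem exists_fixedField_algEquiv_fractionRing [Finite G] (hy : AlgebraicIndependent k y)
    (hρ : ∀ g i, ρ g (y i) = (c g i : k) • y i)
    (hgen : ∀ f : L, ∃ p q : MvPolynomial ι k,
      MvPolynomial.aeval y q ≠ 0 ∧ f * MvPolynomial.aeval y q = MvPolynomial.aeval y p) :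
    ∃ r : ℕ, Nonempty (IntermediateField.fixedField ρ.range ≃ₐ[k]
      FractionRing (MvPolynomial (Fin r) k)) := by
  let b := Module.finBasis ℤ (invariantExponents c)
  have hy0 : ∀ i, y i ≠ 0 := fun i ↦ hy.ne_zero i
  have hb : LinearIndependent ℤ fun j ↦ (b j : ι → ℤ) :=
    b.linearIndependent.map' (Submodule.subtype _) (Submodule.ker_subtype _)
  have hfix : IntermediateField.fixedField ρ.range =
      IntermediateField.adjoin k (Set.range fun j ↦ laurentMonomial y (b j)) := by
    rw [fixedField_eq_adjoin_laurentMonomial hy hρ hgen]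
    apply le_antisymm <;> rw [IntermediateField.adjoin_le_iff]
    · rintro _ ⟨m, hm, rfl⟩
      have : m = ∑ j, b.repr ⟨m, hm⟩ j • (b j : ι → ℤ) := by
        have := congrArg (Submodule.subtype _) (b.sum_repr ⟨m, hm⟩)
        rw [map_sum] at this
        exact this.symm
      rw [this, laurentMonomial_sum hy0]
      exact prod_mem fun j _ ↦
        zpow_mem (IntermediateField.subset_adjoin k _ (Set.mem_range_self j)) _
    · rintro _ ⟨j, rfl⟩
      exact IntermediateField.subset_adjoin _ _ ⟨b j, (b j).2, rfl⟩
  exact ⟨_, ⟨(IntermediateField.equivOfEq hfix).trans (hy.laurentMonomial hb).aevalEquivField.symm⟩⟩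

end Diagonal

end LaurentMonomial

section Characters

variable {k A : Type*} [Field k] [CommGroup A] [Fintype A]

theorem natCast_card_ne_zero_of_forall_pow_eq_one {m : ℕ} (hmk : (m : k) ≠ 0)
    (hA : ∀ a : A, a ^ m = 1) : (Fintype.card A : k) ≠ 0 := by
  intro h
  obtain ⟨p, hp⟩ := CharP.exists k
  have hpA : p ∣ Fintype.card A := (CharP.cast_eq_zero_iff k p _).1 h
  have hp0 : p ≠ 0 := by
    rintro rfl
    exact Fintype.card_ne_zero (zero_dvd_iff.1 hpA)
  have : Fact p.Prime := ⟨(CharP.char_is_prime_or_zero k p).resolve_right hp0⟩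
  obtain ⟨a, ha⟩ := exists_prime_orderOf_dvd_card p hpA
  exact hmk ((CharP.cast_eq_zero_iff k p m).2 (ha ▸ orderOf_dvd_of_pow_eq_one (hA a)))

theorem sum_char_mul_inv [DecidableEq (A →* kˣ)] (χ ψ : A →* kˣ) :
    ∑ a, (χ a : k) * (ψ a⁻¹ : kˣ) = if χ = ψ then (Fintype.card A : k) else 0 := by
  classical
  have h := sum_hom_units ((Units.coeHom k).comp (χ * ψ⁻¹))
  have h1 : (Units.coeHom k).comp (χ * ψ⁻¹) = 1 ↔ χ = ψ := by
    rw [← mul_inv_eq_one (a := χ)]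
    refine ⟨fun h ↦ ?_, fun h ↦ by rw [h, MonoidHom.comp_one]⟩
    ext a
    exact DFunLike.congr_fun h a
  simp only [h1] at h
  simpa using h

theorem sum_char_apply_eq_ite [DecidableEq A] [Fintype (A →* kˣ)]
    [HasEnoughRootsOfUnity k (Monoid.exponent A)] (a : A) :
    ∑ χ : A →* kˣ, (χ a : k) = if a = 1 then (Fintype.card A : k) else 0 := by
  split_ifs with h
  · have := CommGroup.card_monoidHom_of_hasEnoughRootsOfUnity A k
    rw [Nat.card_eq_fintype_card, Nat.card_eq_fintype_card] at this
    simp [h, this]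
  · obtain ⟨φ, hφ⟩ := CommGroup.exists_apply_ne_one_of_hasEnoughRootsOfUnity A k h
    refine eq_zero_of_mul_eq_self_left (b := (φ a : k)) (by simpa using hφ) ?_
    rw [Finset.mul_sum]
    exact Fintype.sum_equiv (Equiv.mulLeft φ) _ _ fun χ ↦ by simp

/-- The character sum `∑ a, χ a • x_a`. -/
noncomputable def charSum (χ : A →* kˣ) : MvPolynomial A k :=
  ∑ a, (χ a : k) • MvPolynomial.X a

/-- The linear change of variables inverse to `χ ↦ charSum χ`. -/
noncomputable def invCharSum [Fintype (A →* kˣ)] (a : A) : MvPolynomial (A →* kˣ) k :=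
  (Fintype.card A : k)⁻¹ • ∑ χ : A →* kˣ, ((χ a⁻¹ : kˣ) : k) • MvPolynomial.X χ

theorem aeval_invCharSum_charSum [Fintype (A →* kˣ)] (hA : (Fintype.card A : k) ≠ 0)
    (χ : A →* kˣ) : MvPolynomial.aeval invCharSum (charSum χ) = MvPolynomial.X χ := by
  classical
  simp only [charSum, invCharSum, map_sum, map_smul, MvPolynomial.aeval_X, Finset.smul_sum,
    smul_smul]
  rw [Finset.sum_comm]
  simp only [mul_left_comm _ (Fintype.card A : k)⁻¹, ← Finset.sum_smul, ← Finset.mul_sum,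
    sum_char_mul_inv, mul_ite, inv_mul_cancel₀ hA, mul_zero, ite_smul, one_smul, zero_smul]
  simp

theorem aeval_charSum_invCharSum [Fintype (A →* kˣ)]
    [HasEnoughRootsOfUnity k (Monoid.exponent A)] (hA : (Fintype.card A : k) ≠ 0) (a : A) :
    MvPolynomial.aeval charSum (invCharSum (k := k) a) = MvPolynomial.X a := by
  classical
  simp only [charSum, invCharSum, map_sum, map_smul, MvPolynomial.aeval_X, Finset.smul_sum,
    smul_smul]
  rw [Finset.sum_comm]
  simp only [mul_assoc, ← Finset.sum_smul, ← Finset.mul_sum, ← Units.val_mul, ← map_mul,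
    sum_char_apply_eq_ite, inv_mul_eq_one, mul_ite, inv_mul_cancel₀ hA, mul_zero, ite_smul,
    one_smul, zero_smul]
  simp

end Characters

/-- **Fischer's theorem.** Let `m > 0`, `k` a field in which `m` is invertible
and containing a primitive `m`-th root of unity, and `A` a finite abelian group of exponent
dividing `m`.  Let `A` act on `L = k(x_a : a ∈ A)` by `k`-automorphisms with `b · x_a = x_{ba}`
(such an action `ρ` being uniquely determined by this requirement), and let `K = L^A` be the
fixed field.  Then `K` is stably rational over `k`: some purely transcendental extension
`K(t₁, …, tₙ)` is `k`-isomorphic to a rational function field `k(s₁, …, s_{n'})`. -/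
theorem stmt11 (m : ℕ) (hm : 0 < m) (k : Type*) [Field k] (hmk : (m : k) ≠ 0)
    (ζ : k) (hζ : IsPrimitiveRoot ζ m)
    (A : Type*) [CommGroup A] [Finite A] (hA : ∀ a : A, a ^ m = 1)
    (ρ : A →* (FractionRing (MvPolynomial A k) ≃ₐ[k] FractionRing (MvPolynomial A k)))
    (hρ : ∀ b a : A,
      ρ b (algebraMap (MvPolynomial A k) (FractionRing (MvPolynomial A k)) (MvPolynomial.X a))
        = algebraMap (MvPolynomial A k) (FractionRing (MvPolynomial A k))
            (MvPolynomial.X (b * a))) :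
    ∃ n n' : ℕ,
      Nonempty
        ((FractionRing (MvPolynomial (Fin n) ↥(IntermediateField.fixedField ρ.range)))
          ≃ₐ[k] FractionRing (MvPolynomial (Fin n') k)) := by
  have := Fintype.ofFinite A
  have : NeZero m := ⟨hm.ne'⟩
  have : HasEnoughRootsOfUnity k m := ⟨⟨ζ, hζ⟩, inferInstance⟩
  have : HasEnoughRootsOfUnity k (Monoid.exponent A) :=
    HasEnoughRootsOfUnity.of_dvd k (Monoid.exponent_dvd_of_forall_pow_eq_one hA)
  have : Finite (A →* kˣ) :=
    Finite.of_equiv A (CommGroup.monoidHom_mulEquiv_of_hasEnoughRootsOfUnity A k).some.symm.toEquiv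
  have := Fintype.ofFinite (A →* kˣ)
  have hcard : (Fintype.card A : k) ≠ 0 := natCast_card_ne_zero_of_forall_pow_eq_one hmk hA
  let incl := IsScalarTower.toAlgHom k (MvPolynomial A k) (FractionRing (MvPolynomial A k))
  have hincl : Function.Injective incl := IsFractionRing.injective _ _
  let y : (A →* kˣ) → FractionRing (MvPolynomial A k) := fun χ ↦ incl (charSum χ)
  have haeval : ∀ p, MvPolynomial.aeval y p = incl (MvPolynomial.aeval charSum p) := fun p ↦
    (MvPolynomial.comp_aeval_apply charSum incl p).symm
  have hleft : ∀ p, MvPolynomial.aeval invCharSum (MvPolynomial.aeval (charSum (k := k) (A := A)) p)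
      = p := fun p ↦ by
    rw [MvPolynomial.comp_aeval_apply]
    simp only [aeval_invCharSum_charSum hcard, MvPolynomial.aeval_X_left_apply]
  have hright : ∀ p : MvPolynomial A k,
      MvPolynomial.aeval charSum (MvPolynomial.aeval invCharSum p) = p := fun p ↦ by
    rw [MvPolynomial.comp_aeval_apply]
    simp only [aeval_charSum_invCharSum hcard, MvPolynomial.aeval_X_left_apply]
  have hy : AlgebraicIndependent k y := by
    intro p q hpq
    exact Function.LeftInverse.injective hleft (hincl (by rwa [haeval, haeval] at hpq))
  have hgen : ∀ f : FractionRing (MvPolynomial A k), ∃ p q : MvPolynomial (A →* kˣ) k,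
      MvPolynomial.aeval y q ≠ 0 ∧ f * MvPolynomial.aeval y q = MvPolynomial.aeval y p := by
    intro f
    obtain ⟨p, q, hq, rfl⟩ := IsFractionRing.div_surjective (A := MvPolynomial A k) f
    have hq0 : incl q ≠ 0 := (map_ne_zero_iff _ hincl).2 (nonZeroDivisors.ne_zero hq)
    refine ⟨MvPolynomial.aeval invCharSum p, MvPolynomial.aeval invCharSum q, ?_, ?_⟩
    · rwa [haeval, hright]
    · rw [haeval, haeval, hright, hright]
      exact div_mul_cancel₀ _ hq0
  have hρy : ∀ b χ, ρ b (y χ) = (((χ b)⁻¹ : kˣ) : k) • y χ := by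
    intro b χ
    simp only [y, charSum, map_sum, map_smul, Finset.smul_sum, smul_smul]
    refine Fintype.sum_equiv (Equiv.mulLeft b) _ _ fun a ↦ ?_
    have : ρ b (incl (MvPolynomial.X a)) = incl (MvPolynomial.X (b * a)) := hρ b a
    rw [this]
    simp
  obtain ⟨r, ⟨e⟩⟩ := exists_fixedField_algEquiv_fractionRing hy hρy hgen
  let K := IntermediateField.fixedField ρ.range
  have hK : nonZeroDivisors (MvPolynomial (Fin 0) K) ≤ IsUnit.submonoid _ := fun p hp ↦ by
    have h0 := nonZeroDivisors.ne_zero hp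
    have := MvPolynomial.isEmptyAlgEquiv K (Fin 0)
    exact (isUnit_map_iff this p).1 ((this.map_ne_zero_iff.2 h0).isUnit)
  let e₀ := (IsLocalization.atUnits (MvPolynomial (Fin 0) K) (nonZeroDivisors _)
    (S := FractionRing (MvPolynomial (Fin 0) K)) hK).restrictScalars k
  let e₁ := (MvPolynomial.isEmptyAlgEquiv K (Fin 0)).restrictScalars k
  exact ⟨0, r, ⟨e₀.symm.trans (e₁.trans e)⟩⟩
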